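/- Fix i ≠ j in I and set m = 1 − a_{ij}. Then, as linear operators on U⁺, ∑_{k=0}^{m−1} (−1)^k binom(m,k)_{r_i s_i^{−1}} (m−k)_{r_i^{−1} s_i} c^{(k)}_{ij} r^{−⟨α_i,α_j⟩} s^{⟨α_j,α_i⟩} (r_i^{−1} s_i)^k ∂_i^{m−k−1} ∘ ∂_j ∘ ∂_i^k = − ∑_{k=1}^{m} (−1)^k binom(m,k)_{r_i s_i^{−1}} (k)_{r_i^{−1} s_i} c^{(k)}_{ij} ∂_i^{m−k} ∘ ∂_j ∘ ∂_i^{k−1} (i.e., S₂ = −S₃ in the notation of the paper). -/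

import Mathlib

noncomputable section

/-- The q-integer `(m)_v = 1 + v + ⋯ + v^{m-1}`. -/
def qnat {K : Type} [CommRing K] (v : K) (m : ℕ) : K := ∑ i ∈ Finset.range m, v ^ i

/-- The Gaussian binomial coefficient `binom(m,k)_v`, as a polynomial expression in `v`
(defined through the Pascal-type recurrence). -/
def qbinom {K : Type} [CommRing K] (v : K) : ℕ → ℕ → K
  | _, 0 => 1
  | 0, _ + 1 => 0
  | m + 1, k + 1 => qbinom v m k + v ^ (k + 1) * qbinom v m (k + 1)

/-- The Euler (Ringel) form on basis elements: `⟨α_i, α_j⟩ = d_i a_{ij}` if `i < j`,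
`d_i` if `i = j`, and `0` if `i > j`. -/
def eulB {n : ℕ} (a : Fin n → Fin n → ℤ) (d : Fin n → ℤ) (i j : Fin n) : ℤ :=
  if i < j then d i * a i j else if i = j then d i else 0

/-- The Euler form on the root lattice `Q = Fin n → ℤ` (coordinates in the basis `α_i`). -/
def euler {n : ℕ} (a : Fin n → Fin n → ℤ) (d : Fin n → ℤ) (μ ν : Fin n → ℤ) : ℤ :=
  ∑ i, ∑ j, μ i * ν j * eulB a d i j

/-- The coefficient `c^{(k)}_{ij} = (r_i s_i⁻¹)^{k(k-1)/2} r^{k⟨α_j,α_i⟩} s^{-k⟨α_i,α_j⟩}`. -/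
def ccoef {K : Type} [Field K] {n : ℕ} (a : Fin n → Fin n → ℤ) (d : Fin n → ℤ)
    (r s : K) (i j : Fin n) (k : ℕ) : K :=
  (r ^ d i * (s ^ d i)⁻¹) ^ (k * (k - 1) / 2) *
    r ^ ((k : ℤ) * eulB a d j i) * (s ^ ((k : ℤ) * eulB a d i j))⁻¹

/-- The `(r,s)`-Serre element
`∑_{k=0}^{1-a_{ij}} (-1)^k binom(1-a_{ij},k)_{r_i s_i⁻¹} c^{(k)}_{ij} E_i^{1-a_{ij}-k} E_j E_i^k`. -/
def serreElt {K : Type} [Field K] {n : ℕ} (a : Fin n → Fin n → ℤ) (d : Fin n → ℤ)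
    (r s : K) {A : Type} [Ring A] [Algebra K A] (E : Fin n → A) (i j : Fin n) : A :=
  ∑ k ∈ Finset.range ((1 - a i j).toNat + 1),
    ((-1 : K) ^ k * qbinom (r ^ d i * (s ^ d i)⁻¹) ((1 - a i j).toNat) k *
        ccoef a d r s i j k) •
      (E i ^ ((1 - a i j).toNat - k) * E j * E i ^ k)

/-- The defining relations of `U⁺_{r,s}`: the `(r,s)`-Serre relations. -/
inductive SerreRel (K : Type) [Field K] {n : ℕ} (a : Fin n → Fin n → ℤ) (d : Fin n → ℤ)
    (r s : K) : FreeAlgebra K (Fin n) → FreeAlgebra K (Fin n) → Prop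
  | rel (i j : Fin n) (h : i ≠ j) :
      SerreRel K a d r s (serreElt a d r s (FreeAlgebra.ι K) i j) 0

/-- `U⁺_{r,s}`: the algebra generated by the `e_i` subject only to the `(r,s)`-Serre
relations. -/
abbrev Uplus (K : Type) [Field K] {n : ℕ} (a : Fin n → Fin n → ℤ) (d : Fin n → ℤ)
    (r s : K) : Type := RingQuot (SerreRel K a d r s)

/-- The generator `e_i` of `U⁺_{r,s}`. -/
def eP (K : Type) [Field K] {n : ℕ} (a : Fin n → Fin n → ℤ) (d : Fin n → ℤ)
    (r s : K) (i : Fin n) : Uplus K a d r s :=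
  RingQuot.mkAlgHom K (SerreRel K a d r s) (FreeAlgebra.ι K i)

/-- The degree-`μ` homogeneous component of `U⁺_{r,s}` for `μ ∈ Q⁺`: the span of the
monomials in the `e_i` in which `e_i` occurs exactly `μ i` times. -/
def UplusDeg (K : Type) [Field K] {n : ℕ} (a : Fin n → Fin n → ℤ) (d : Fin n → ℤ)
    (r s : K) (μ : Fin n → ℕ) : Submodule K (Uplus K a d r s) :=
  Submodule.span K
    {x | ∃ w : List (Fin n), (∀ i, w.count i = μ i) ∧ x = (w.map (eP K a d r s)).prod}


/-- The `(r,s)`-Serre element for the negative generators: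
`∑_{k=0}^{1-a_{ij}} (-1)^k binom(1-a_{ij},k)_{r_i s_i⁻¹} c^{(k)}_{ij} F_i^k F_j F_i^{1-a_{ij}-k}`. -/
def serreEltF {K : Type} [Field K] {n : ℕ} (a : Fin n → Fin n → ℤ) (d : Fin n → ℤ)
    (r s : K) {A : Type} [Ring A] [Algebra K A] (F : Fin n → A) (i j : Fin n) : A :=
  ∑ k ∈ Finset.range ((1 - a i j).toNat + 1),
    ((-1 : K) ^ k * qbinom (r ^ d i * (s ^ d i)⁻¹) ((1 - a i j).toNat) k *
        ccoef a d r s i j k) •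
      (F i ^ k * F j * F i ^ ((1 - a i j).toNat - k))

/-- The field `ℚ(r,s)` of rational functions in two variables over `ℚ`. -/
abbrev K2 : Type := FractionRing (MvPolynomial (Fin 2) ℚ)

/-- The parameter `r ∈ ℚ(r,s)`. -/
def rr : K2 := algebraMap (MvPolynomial (Fin 2) ℚ) K2 (MvPolynomial.X 0)

/-- The parameter `s ∈ ℚ(r,s)`. -/
def ss : K2 := algebraMap (MvPolynomial (Fin 2) ℚ) K2 (MvPolynomial.X 1)

/-- Generators of the two-parameter quantum group `U_{r,s}(𝔤)`:
`e_i, f_i, ω_i^{±1}, ω_i'^{±1}`. -/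
inductive Gen (n : ℕ) : Type
  | e (i : Fin n) : Gen n
  | f (i : Fin n) : Gen n
  | w (i : Fin n) : Gen n
  | winv (i : Fin n) : Gen n
  | w' (i : Fin n) : Gen n
  | w'inv (i : Fin n) : Gen n

/-- The four toral generators `ω_i, ω_i^{-1}, ω_i', ω_i'^{-1}` attached to `i`. -/
def tor {n : ℕ} (i : Fin n) : Bool → Bool → Gen n
  | false, false => Gen.w i
  | false, true => Gen.winv i
  | true, false => Gen.w' i
  | true, true => Gen.w'inv i

/-- The defining relations (R1)–(R6) of the two-parameter quantum group `U_{r,s}(𝔤)`. -/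
inductive URel {n : ℕ} (a : Fin n → Fin n → ℤ) (d : Fin n → ℤ) :
    FreeAlgebra K2 (Gen n) → FreeAlgebra K2 (Gen n) → Prop
  | torComm (i j : Fin n) (p q p' q' : Bool) :
      URel a d (FreeAlgebra.ι K2 (tor i p q) * FreeAlgebra.ι K2 (tor j p' q'))
        (FreeAlgebra.ι K2 (tor j p' q') * FreeAlgebra.ι K2 (tor i p q))
  | wInvR (i : Fin n) :
      URel a d (FreeAlgebra.ι K2 (Gen.w i) * FreeAlgebra.ι K2 (Gen.winv i)) 1
  | wInvL (i : Fin n) :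
      URel a d (FreeAlgebra.ι K2 (Gen.winv i) * FreeAlgebra.ι K2 (Gen.w i)) 1
  | w'InvR (i : Fin n) :
      URel a d (FreeAlgebra.ι K2 (Gen.w' i) * FreeAlgebra.ι K2 (Gen.w'inv i)) 1
  | w'InvL (i : Fin n) :
      URel a d (FreeAlgebra.ι K2 (Gen.w'inv i) * FreeAlgebra.ι K2 (Gen.w' i)) 1
  | we (i j : Fin n) :
      URel a d (FreeAlgebra.ι K2 (Gen.w i) * FreeAlgebra.ι K2 (Gen.e j))
        ((rr ^ eulB a d j i * (ss ^ eulB a d i j)⁻¹) •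
          (FreeAlgebra.ι K2 (Gen.e j) * FreeAlgebra.ι K2 (Gen.w i)))
  | w'e (i j : Fin n) :
      URel a d (FreeAlgebra.ι K2 (Gen.w' i) * FreeAlgebra.ι K2 (Gen.e j))
        (((rr ^ eulB a d i j)⁻¹ * ss ^ eulB a d j i) •
          (FreeAlgebra.ι K2 (Gen.e j) * FreeAlgebra.ι K2 (Gen.w' i)))
  | wf (i j : Fin n) :
      URel a d (FreeAlgebra.ι K2 (Gen.w i) * FreeAlgebra.ι K2 (Gen.f j))
        (((rr ^ eulB a d j i)⁻¹ * ss ^ eulB a d i j) •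
          (FreeAlgebra.ι K2 (Gen.f j) * FreeAlgebra.ι K2 (Gen.w i)))
  | w'f (i j : Fin n) :
      URel a d (FreeAlgebra.ι K2 (Gen.w' i) * FreeAlgebra.ι K2 (Gen.f j))
        ((rr ^ eulB a d i j * (ss ^ eulB a d j i)⁻¹) •
          (FreeAlgebra.ι K2 (Gen.f j) * FreeAlgebra.ι K2 (Gen.w' i)))
  | ef (i j : Fin n) :
      URel a d
        (FreeAlgebra.ι K2 (Gen.e i) * FreeAlgebra.ι K2 (Gen.f j) -
          FreeAlgebra.ι K2 (Gen.f j) * FreeAlgebra.ι K2 (Gen.e i))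
        (if i = j then
          ((rr ^ d i - ss ^ d i)⁻¹) •
            (FreeAlgebra.ι K2 (Gen.w i) - FreeAlgebra.ι K2 (Gen.w' i))
         else 0)
  | serreE (i j : Fin n) (h : i ≠ j) :
      URel a d (serreElt a d rr ss (fun k => FreeAlgebra.ι K2 (Gen.e k)) i j) 0
  | serreF (i j : Fin n) (h : i ≠ j) :
      URel a d (serreEltF a d rr ss (fun k => FreeAlgebra.ι K2 (Gen.f k)) i j) 0

/-- The two-parameter quantum group `U_{r,s}(𝔤)` over `ℚ(r,s)`. -/
abbrev Uq {n : ℕ} (a : Fin n → Fin n → ℤ) (d : Fin n → ℤ) : Type :=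
  RingQuot (URel a d)

/-- The image of a generator in `U_{r,s}(𝔤)`. -/
def gU {n : ℕ} (a : Fin n → Fin n → ℤ) (d : Fin n → ℤ) (x : Gen n) : Uq a d :=
  RingQuot.mkAlgHom K2 (URel a d) (FreeAlgebra.ι K2 x)

/-- The subalgebra `U⁺` of `U_{r,s}(𝔤)` generated by the `e_i`. -/
def Upos {n : ℕ} (a : Fin n → Fin n → ℤ) (d : Fin n → ℤ) : Subalgebra K2 (Uq a d) :=
  Algebra.adjoin K2 (Set.range fun i => gU a d (Gen.e i))

/-- The subalgebra `U⁻` of `U_{r,s}(𝔤)` generated by the `f_i`. -/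
def Uneg {n : ℕ} (a : Fin n → Fin n → ℤ) (d : Fin n → ℤ) : Subalgebra K2 (Uq a d) :=
  Algebra.adjoin K2 (Set.range fun i => gU a d (Gen.f i))

/-- The subalgebra `U⁰` of `U_{r,s}(𝔤)` generated by the `ω_i^{±1}, ω_i'^{±1}`. -/
def Uzero {n : ℕ} (a : Fin n → Fin n → ℤ) (d : Fin n → ℤ) : Subalgebra K2 (Uq a d) :=
  Algebra.adjoin K2 (Set.range fun p : Fin n × Bool × Bool => gU a d (tor p.1 p.2.1 p.2.2))

/-- The generator `e_i` of `U⁺ ⊆ U_{r,s}(𝔤)`, as an element of the subalgebra `U⁺`. -/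
def eUp {n : ℕ} (a : Fin n → Fin n → ℤ) (d : Fin n → ℤ) (i : Fin n) : ↥(Upos a d) :=
  ⟨gU a d (Gen.e i), Algebra.subset_adjoin (Set.mem_range_self i)⟩

theorem qnat_succ_eq_add {K : Type} [CommRing K] (v : K) (m : ℕ) :
    qnat v (m + 1) = qnat v m + v ^ m :=
  Finset.sum_range_succ _ _

theorem qnat_succ_eq_one_add {K : Type} [CommRing K] (v : K) (m : ℕ) :
    qnat v (m + 1) = 1 + v * qnat v m := by
  simp only [qnat, Finset.sum_range_succ', Finset.mul_sum, pow_succ', pow_zero]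
  ring

theorem qnat_inv_succ {K : Type} [Field K] {v : K} (hv : v ≠ 0) (m : ℕ) :
    qnat v⁻¹ (m + 1) * v ^ m = qnat v (m + 1) := by
  induction m with
  | zero => simp [qnat]
  | succ m ih =>
    rw [qnat_succ_eq_add v⁻¹, qnat_succ_eq_one_add v (m + 1), ← ih, add_mul, ← mul_pow,
      inv_mul_cancel₀ hv, one_pow, pow_succ]
    ring

theorem qbinom_eq_zero_of_lt {K : Type} [CommRing K] (v : K) {m k : ℕ} (h : m < k) :
    qbinom v m k = 0 := by
  induction m generalizing k with
  | zero =>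
    obtain ⟨k, rfl⟩ := Nat.exists_eq_succ_of_ne_zero h.ne'
    rfl
  | succ m ih =>
    obtain ⟨k, rfl⟩ := Nat.exists_eq_succ_of_ne_zero (Nat.ne_zero_of_lt h)
    simp [qbinom, ih (show m < k by omega), ih (show m < k + 1 by omega)]

theorem qbinom_succ_succ {K : Type} [CommRing K] (v : K) (m k : ℕ) :
    qbinom v (m + 1) (k + 1) = qbinom v m k + v ^ (k + 1) * qbinom v m (k + 1) :=
  rfl

@[simp]
theorem qbinom_zero_right {K : Type} [CommRing K] (v : K) (m : ℕ) : qbinom v m 0 = 1 := by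
  cases m <;> rfl

theorem qbinom_mul_qnat_sub {K : Type} [CommRing K] (v : K) (m k : ℕ) :
    qbinom v m k * qnat v (m - k) = qbinom v m (k + 1) * qnat v (k + 1) := by
  induction m generalizing k with
  | zero => simp [qbinom_eq_zero_of_lt, qnat]
  | succ m ih =>
    cases k with
    | zero =>
      have h := ih 0
      rw [qbinom_zero_right, one_mul, Nat.sub_zero] at h
      simp only [qbinom, qbinom_zero_right, Nat.sub_zero, qnat_succ_eq_one_add v m, h]
      simp [qnat]
    | succ k =>
      rcases lt_or_ge k m with hk | hk
      · obtain ⟨l, rfl⟩ := Nat.exists_eq_add_of_lt hk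
        have h₁ := ih k
        have h₂ := ih (k + 1)
        rw [show k + l + 1 - k = l + 1 by omega] at h₁
        rw [show k + l + 1 - (k + 1) = l by omega] at h₂
        rw [show k + l + 1 + 1 - (k + 1) = l + 1 by omega]
        rw [qbinom_succ_succ v _ k, qbinom_succ_succ v _ (k + 1)]
        rw [qnat_succ_eq_one_add v l] at h₁ ⊢
        rw [qnat_succ_eq_add v (k + 1)] at h₂ ⊢
        linear_combination h₁ + v ^ (k + 2) * h₂
      · rw [qbinom_eq_zero_of_lt v (show m + 1 < k + 1 + 1 by omega),
          show m + 1 - (k + 1) = 0 by omega]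
        simp [qnat]

theorem eulB_add_eulB {n : ℕ} {a : Fin n → Fin n → ℤ} {d : Fin n → ℤ}
    (hsym : ∀ i j, d i * a i j = d j * a j i) {i j : Fin n} (hij : i ≠ j) :
    eulB a d i j + eulB a d j i = d i * a i j := by
  rcases lt_or_gt_of_ne hij with h | h
  · simp [eulB, h, h.not_gt, h.ne']
  · simp [eulB, h, h.not_gt, h.ne', hsym i j]

theorem ccoef_succ {K : Type} [Field K] {n : ℕ} (a : Fin n → Fin n → ℤ) (d : Fin n → ℤ)
    {r s : K} (hr : r ≠ 0) (hs : s ≠ 0) (i j : Fin n) (k : ℕ) :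
    ccoef a d r s i j (k + 1) =
      ccoef a d r s i j k * (r ^ d i * (s ^ d i)⁻¹) ^ k *
        (r ^ eulB a d j i * (s ^ eulB a d i j)⁻¹) := by
  have h : (k + 1) * (k + 1 - 1) / 2 = k * (k - 1) / 2 + k := by
    rw [← Nat.choose_two_right, ← Nat.choose_two_right, Nat.choose_succ_succ' k 1,
      Nat.choose_one_right, add_comm]
  simp only [ccoef]
  rw [h]
  simp only [Nat.cast_add, Nat.cast_one, add_mul, one_mul, zpow_add₀ hr,
    zpow_add₀ hs, pow_add, mul_inv]
  ring

theorem rr_ne_zero : rr ≠ 0 := by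
  simp [rr]

theorem ss_ne_zero : ss ≠ 0 := by
  simp [ss]

theorem qbinom_mul_qnat_inv_mul_ccoef {K : Type} [Field K] {n : ℕ}
    {a : Fin n → Fin n → ℤ} {d : Fin n → ℤ}
    (hsym : ∀ i j, d i * a i j = d j * a j i) {r s : K} (hr : r ≠ 0) (hs : s ≠ 0)
    {i j : Fin n} (hij : i ≠ j) {m k : ℕ} (hm : (m : ℤ) = 1 - a i j) (hk : k < m) :
    qbinom (r ^ d i * (s ^ d i)⁻¹) m k * qnat ((r ^ d i)⁻¹ * s ^ d i) (m - k) *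
          ccoef a d r s i j k * ((r ^ eulB a d i j)⁻¹ * s ^ eulB a d j i) *
          ((r ^ d i)⁻¹ * s ^ d i) ^ k =
      qbinom (r ^ d i * (s ^ d i)⁻¹) m (k + 1) * qnat ((r ^ d i)⁻¹ * s ^ d i) (k + 1) *
          ccoef a d r s i j (k + 1) := by
  obtain ⟨l, rfl⟩ := Nat.exists_eq_add_of_lt hk
  have hv : r ^ d i * (s ^ d i)⁻¹ ≠ 0 :=
    mul_ne_zero (zpow_ne_zero _ hr) (inv_ne_zero (zpow_ne_zero _ hs))
  have hinv : (r ^ d i)⁻¹ * s ^ d i = (r ^ d i * (s ^ d i)⁻¹)⁻¹ := by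
    rw [mul_inv, inv_inv]
  have hpow : (r ^ eulB a d j i * (s ^ eulB a d i j)⁻¹) *
      (r ^ d i * (s ^ d i)⁻¹) ^ (k + l) = (r ^ eulB a d i j)⁻¹ * s ^ eulB a d j i := by
    have he := eulB_add_eulB hsym hij
    have ha : a i j = -((k + l : ℕ) : ℤ) := by push_cast at hm ⊢; linarith
    rw [ha] at he
    have he₁ : eulB a d j i + d i * ((k + l : ℕ) : ℤ) = -eulB a d i j := by linarith
    have he₂ : -eulB a d i j + -(d i * ((k + l : ℕ) : ℤ)) = eulB a d j i := by linarith
    rw [mul_pow, inv_pow, ← zpow_natCast (r ^ d i), ← zpow_natCast (s ^ d i),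
      ← zpow_mul, ← zpow_mul, mul_mul_mul_comm, ← zpow_add₀ hr, ← zpow_neg s, ← zpow_neg s,
      ← zpow_add₀ hs, he₁, he₂, zpow_neg]
  rw [ccoef_succ a d hr hs, hinv, ← hpow]
  generalize r ^ d i * (s ^ d i)⁻¹ = v at hv ⊢
  have h := qbinom_mul_qnat_sub v (k + l + 1) k
  rw [show k + l + 1 - k = l + 1 by omega] at h ⊢
  rw [← qnat_inv_succ hv, ← qnat_inv_succ hv] at h
  have hk' : v ^ k * v⁻¹ ^ k = 1 := by rw [← mul_pow, mul_inv_cancel₀ hv, one_pow]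
  generalize r ^ eulB a d j i * (s ^ eulB a d i j)⁻¹ = t
  generalize ccoef a d r s i j k = c
  linear_combination (c * t) * h +
    qbinom v (k + l + 1) k * qnat v⁻¹ (l + 1) * c * t * v ^ l * hk'

set_option synthInstance.maxHeartbeats 1000000
set_option maxHeartbeats 1000000

/-- **Lemma 4.4 (i).** With `m = 1 - a_{ij}` (for `i ≠ j`), as operators on `U⁺`,
`S₂ = -S₃`, i.e.
`∑_{k=0}^{m-1} (-1)^k binom(m,k)_{r_i s_i⁻¹} (m-k)_{r_i⁻¹ s_i} c^{(k)}_{ij}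
r^{-⟨α_i,α_j⟩} s^{⟨α_j,α_i⟩} (r_i⁻¹ s_i)^k ∂_i^{m-k-1} ∂_j ∂_i^k
= -∑_{k=1}^{m} (-1)^k binom(m,k)_{r_i s_i⁻¹} (k)_{r_i⁻¹ s_i} c^{(k)}_{ij}
∂_i^{m-k} ∂_j ∂_i^{k-1}`. -/
theorem skew_derivative_S2_eq_neg_S3
    (n : ℕ) (a : Fin n → Fin n → ℤ) (d : Fin n → ℤ)
    (hdiag : ∀ i, a i i = 2) (hoff : ∀ i j, i ≠ j → a i j ≤ 0)
    (hsym : ∀ i j, d i * a i j = d j * a j i) (hdpos : ∀ i, 0 < d i)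
    (hfin : Matrix.PosDef (Matrix.of fun i j : Fin n => ((d i * a i j : ℤ) : ℝ)))
    (D D' : Fin n → (↥(Upos a d) →ₗ[K2] ↥(Upos a d)))
    (hD : ∀ (i : Fin n) (P : ↥(Upos a d)),
      (rr ^ d i - ss ^ d i) •
          ((P : Uq a d) * gU a d (Gen.f i) - gU a d (Gen.f i) * (P : Uq a d)) =
        gU a d (Gen.w i) * (D i P : Uq a d) - gU a d (Gen.w' i) * (D' i P : Uq a d))
    (i j : Fin n) (hij : i ≠ j) :
    ∑ k ∈ Finset.range ((1 - a i j).toNat),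
      ((-1 : K2) ^ k * qbinom (rr ^ d i * (ss ^ d i)⁻¹) ((1 - a i j).toNat) k *
          qnat ((rr ^ d i)⁻¹ * ss ^ d i) ((1 - a i j).toNat - k) *
          ccoef a d rr ss i j k *
          ((rr ^ eulB a d i j)⁻¹ * ss ^ eulB a d j i) *
          ((rr ^ d i)⁻¹ * ss ^ d i) ^ k) •
        ((D i ^ ((1 - a i j).toNat - k - 1)) ∘ₗ (D j) ∘ₗ (D i ^ k)) =
    ∑ k ∈ Finset.Icc 1 ((1 - a i j).toNat),
      (-((-1 : K2) ^ k * qbinom (rr ^ d i * (ss ^ d i)⁻¹) ((1 - a i j).toNat) k *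
          qnat ((rr ^ d i)⁻¹ * ss ^ d i) k * ccoef a d rr ss i j k)) •
        ((D i ^ ((1 - a i j).toNat - k)) ∘ₗ (D j) ∘ₗ (D i ^ (k - 1))) := by
  have hm : (((1 - a i j).toNat : ℕ) : ℤ) = 1 - a i j :=
    Int.toNat_of_nonneg (by linarith [hoff i j hij])
  rw [Finset.range_eq_Ico, ← Finset.Ico_add_one_right_eq_Icc,
    ← Finset.sum_Ico_add' _ 0 (1 - a i j).toNat 1]
  refine Finset.sum_congr rfl fun k hk => ?_
  rw [Nat.sub_sub, Nat.add_sub_cancel]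
  congr 1
  have h := qbinom_mul_qnat_inv_mul_ccoef hsym rr_ne_zero ss_ne_zero hij hm
    (Finset.mem_Ico.mp hk).2
  rw [pow_succ (-1 : K2)]
  linear_combination (-1 : K2) ^ k * h

end
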